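/- arXiv:0710.0946 — 2 statements merged into one kernel-verified Lean document; each statement's English description precedes it below -/
import Mathlib

section
/- Let F be ℝ or ℂ and let p, q ≥ 1. For every pair of matrices M, N ∈ F^{p×q} there exist S ∈ F^{p×q}, R ∈ F^{(p−1)×q}, and a matrix H ∈ F^{p×q} that is zero outside its last row, such that M + S J_q − F_p R = H and N + S − K_p R = 0; moreover H is uniquely determined by (M,N). -/
open Matrix

/-- The `r × r` nilpotent upper-triangular Jordan block `J_r`. -/
def jordanBlock (F : Type*) [Zero F] [One F] (r : ℕ) (lam : F) :
    Matrix (Fin r) (Fin r) F :=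
  Matrix.of fun i j =>
    if (i : ℕ) = (j : ℕ) then lam else if (j : ℕ) = (i : ℕ) + 1 then 1 else 0

/-- The `r × (r−1)` matrix `F_r` with `1` in positions `(i, i)` and `0` elsewhere. -/
def Fmat (F : Type*) [Zero F] [One F] (r : ℕ) : Matrix (Fin r) (Fin (r - 1)) F :=
  Matrix.of fun i j => if (i : ℕ) = (j : ℕ) then 1 else 0

/-- The `r × (r−1)` matrix `K_r` with `1` in positions `(i+1, i)` and `0` elsewhere. -/
def Kmat (F : Type*) [Zero F] [One F] (r : ℕ) : Matrix (Fin r) (Fin (r - 1)) F :=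
  Matrix.of fun i j => if (i : ℕ) = (j : ℕ) + 1 then 1 else 0

/-- `H` is zero outside its last row. -/
def IsLastRow {F : Type*} [Zero F] {p q : ℕ} (H : Matrix (Fin p) (Fin q) F) : Prop :=
  ∀ (i : Fin p) (j : Fin q), (i : ℕ) ≠ p - 1 → H i j = 0

section KroneckerRows

variable {F : Type*} [Semiring F] {n q : ℕ}

theorem Fmat_mul_castSucc (R : Matrix (Fin (n + 1 - 1)) (Fin q) F) (i : Fin n) (j : Fin q) :
    (Fmat F (n + 1) * R) i.castSucc j = R i j := by
  rw [Matrix.mul_apply]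
  change ∑ k : Fin n, (if (i : ℕ) = (k : ℕ) then (1 : F) else 0) * R k j = R i j
  simp [← Fin.ext_iff]

theorem Fmat_mul_last (R : Matrix (Fin (n + 1 - 1)) (Fin q) F) (j : Fin q) :
    (Fmat F (n + 1) * R) (Fin.last n) j = 0 := by
  rw [Matrix.mul_apply]
  change ∑ k : Fin n, (if n = (k : ℕ) then (1 : F) else 0) * R k j = 0
  exact Finset.sum_eq_zero fun k _ => by simp [k.isLt.ne']

theorem Kmat_mul_zero (R : Matrix (Fin (n + 1 - 1)) (Fin q) F) (j : Fin q) :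
    (Kmat F (n + 1) * R) 0 j = 0 := by
  rw [Matrix.mul_apply]
  change ∑ k : Fin n, (if 0 = (k : ℕ) + 1 then (1 : F) else 0) * R k j = 0
  simp

theorem Kmat_mul_succ (R : Matrix (Fin (n + 1 - 1)) (Fin q) F) (i : Fin n) (j : Fin q) :
    (Kmat F (n + 1) * R) i.succ j = R i j := by
  rw [Matrix.mul_apply]
  change ∑ k : Fin n, (if (i : ℕ) + 1 = (k : ℕ) + 1 then (1 : F) else 0) * R k j = R i j
  simp [← Fin.ext_iff]

theorem add_Kmat_mul_mul_zero (A : Matrix (Fin (n + 1)) (Fin q) F)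
    (R : Matrix (Fin (n + 1 - 1)) (Fin q) F)
    (J : Matrix (Fin q) (Fin q) F) : (A + Kmat F (n + 1) * R * J) 0 = A 0 := by
  change A 0 + (Kmat F (n + 1) * R * J) 0 = A 0
  rw [Matrix.mul_apply_eq_vecMul, show (Kmat F (n + 1) * R) 0 = 0 from funext (Kmat_mul_zero R),
    Matrix.zero_vecMul, add_zero]

theorem add_Kmat_mul_mul_succ (A : Matrix (Fin (n + 1)) (Fin q) F)
    (R : Matrix (Fin (n + 1 - 1)) (Fin q) F)
    (J : Matrix (Fin q) (Fin q) F) (i : Fin n) :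
    (A + Kmat F (n + 1) * R * J) i.succ = A i.succ + R i ᵥ* J := by
  change A i.succ + (Kmat F (n + 1) * R * J) i.succ = _
  rw [Matrix.mul_apply_eq_vecMul,
    show (Kmat F (n + 1) * R) i.succ = R i from funext (Kmat_mul_succ R i)]

end KroneckerRows

section RowRecursion

variable {F : Type*} [Ring F] {n q : ℕ}

/-- The matrix whose rows satisfy `G 0 = A 0` and `G (i + 1) = A (i + 1) + G i * J`. -/
def rowRecursion (A : Matrix (Fin (n + 1)) (Fin q) F) (J : Matrix (Fin q) (Fin q) F) :
    Matrix (Fin (n + 1)) (Fin q) F :=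
  Matrix.of fun i => Fin.induction (motive := fun _ => Fin q → F) (A 0)
    (fun k x => A k.succ + x ᵥ* J) i

theorem rowRecursion_eq (A : Matrix (Fin (n + 1)) (Fin q) F) (J : Matrix (Fin q) (Fin q) F) :
    rowRecursion A J =
      A + Kmat F (n + 1) *
        (Matrix.of fun i : Fin (n + 1 - 1) => rowRecursion A J i.castSucc) * J := by
  funext i
  cases i using Fin.cases with
  | zero => rw [add_Kmat_mul_mul_zero]; rfl
  | succ k => rw [add_Kmat_mul_mul_succ]; rfl

theorem eq_rowRecursion {A H : Matrix (Fin (n + 1)) (Fin q) F} {J : Matrix (Fin q) (Fin q) F}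
    {R : Matrix (Fin (n + 1 - 1)) (Fin q) F} (hH : IsLastRow H)
    (h : A + Kmat F (n + 1) * R * J - Fmat F (n + 1) * R = H) :
    Fmat F (n + 1) * R + H = rowRecursion A J := by
  have hG : Fmat F (n + 1) * R + H = A + Kmat F (n + 1) * R * J := by rw [← h]; abel
  have hR (k : Fin n) : (Fmat F (n + 1) * R + H) k.castSucc = R k := by
    funext j
    rw [Matrix.add_apply, Fmat_mul_castSucc, hH _ _ (by simpa using k.isLt.ne), add_zero]
  funext i
  induction i using Fin.induction with
  | zero => rw [hG, add_Kmat_mul_mul_zero]; rfl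
  | succ k ih =>
    rw [hR] at ih
    rw [hG, add_Kmat_mul_mul_succ, ih]; rfl

theorem exists_isLastRow (A : Matrix (Fin (n + 1)) (Fin q) F) (J : Matrix (Fin q) (Fin q) F) :
    ∃ R : Matrix (Fin (n + 1 - 1)) (Fin q) F,
      IsLastRow (A + Kmat F (n + 1) * R * J - Fmat F (n + 1) * R) := by
  refine ⟨Matrix.of fun i : Fin (n + 1 - 1) => rowRecursion A J i.castSucc, fun i j hi => ?_⟩
  rw [← rowRecursion_eq]
  cases i using Fin.lastCases with
  | last => simp at hi
  | cast k => rw [Matrix.sub_apply, Fmat_mul_castSucc]; exact sub_self _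

theorem isLastRow_unique {A H H' : Matrix (Fin (n + 1)) (Fin q) F} {J : Matrix (Fin q) (Fin q) F}
    {R R' : Matrix (Fin (n + 1 - 1)) (Fin q) F} (hH : IsLastRow H) (hH' : IsLastRow H')
    (h : A + Kmat F (n + 1) * R * J - Fmat F (n + 1) * R = H)
    (h' : A + Kmat F (n + 1) * R' * J - Fmat F (n + 1) * R' = H') : H = H' := by
  have hG := (eq_rowRecursion hH h).trans (eq_rowRecursion hH' h').symm
  ext i j
  cases i using Fin.lastCases with
  | last =>
    have := congrFun (congrFun hG (Fin.last n)) j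
    rwa [Matrix.add_apply, Matrix.add_apply, Fmat_mul_last, Fmat_mul_last, zero_add, zero_add]
      at this
  | cast k =>
    have hk : ((k.castSucc : Fin (n + 1)) : ℕ) ≠ n + 1 - 1 := by simpa using k.isLt.ne
    rw [hH _ _ hk, hH' _ _ hk]

/-- Eliminating `S` from `N + S - K = 0`. -/
theorem add_mul_eq_of_add_sub_eq_zero {M N S K : Matrix (Fin n) (Fin q) F}
    (J : Matrix (Fin q) (Fin q) F) (h : N + S - K = 0) : M + S * J = M - N * J + K * J := by
  rw [← sub_eq_zero.mp h, Matrix.add_mul]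
  abel

end RowRecursion

/-- Case 3 of the paper's Theorem 3.1: interaction of the Kronecker summands
`(F_p, K_p)` and `(J_q, I_q)`. -/
theorem pencil_case3 (F : Type*) [RCLike F] (p q : ℕ) (hp : 1 ≤ p) (hq : 1 ≤ q)
    (M N : Matrix (Fin p) (Fin q) F) :
    (∃ (S : Matrix (Fin p) (Fin q) F) (R : Matrix (Fin (p - 1)) (Fin q) F)
        (H : Matrix (Fin p) (Fin q) F), IsLastRow H ∧
        M + S * jordanBlock F q 0 - Fmat F p * R = H ∧
        N + S - Kmat F p * R = 0) ∧
    (∀ (S S' : Matrix (Fin p) (Fin q) F) (R R' : Matrix (Fin (p - 1)) (Fin q) F)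
        (H H' : Matrix (Fin p) (Fin q) F), IsLastRow H → IsLastRow H' →
        M + S * jordanBlock F q 0 - Fmat F p * R = H →
        N + S - Kmat F p * R = 0 →
        M + S' * jordanBlock F q 0 - Fmat F p * R' = H' →
        N + S' - Kmat F p * R' = 0 → H = H') := by
  obtain ⟨n, rfl⟩ : ∃ n, p = n + 1 := ⟨p - 1, by omega⟩
  constructor
  · obtain ⟨R, hR⟩ := exists_isLastRow (M - N * jordanBlock F q 0) (jordanBlock F q 0)
    have hS : N + (Kmat F (n + 1) * R - N) - Kmat F (n + 1) * R = 0 := by abel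
    refine ⟨Kmat F (n + 1) * R - N, R, _, hR, ?_, hS⟩
    rw [add_mul_eq_of_add_sub_eq_zero _ hS]
  · intro S S' R R' H H' hH hH' h hS h' hS'
    rw [add_mul_eq_of_add_sub_eq_zero _ hS] at h
    rw [add_mul_eq_of_add_sub_eq_zero _ hS'] at h'
    exact isLastRow_unique hH hH' h h'
end

section
/- Let F be ℝ or ℂ and let p, q ≥ 1. For every pair of matrices M, N ∈ F^{p×q} there exist S ∈ F^{p×(q−1)}, R ∈ F^{(p−1)×q}, a matrix H₁ ∈ F^{p×q} that is zero outside its last column, and a matrix H₂ ∈ F^{p×q} that is zero outside its first row, such that M + S F_q^T − F_p R = H₁ and N + S K_q^T − K_p R = H₂; moreover H₁ and H₂ are uniquely determined by (M,N). -/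
open Matrix

/-- `H` is zero outside its last column. -/
def IsLastCol {F : Type*} [Zero F] {p q : ℕ} (H : Matrix (Fin p) (Fin q) F) : Prop :=
  ∀ (i : Fin p) (j : Fin q), (j : ℕ) ≠ q - 1 → H i j = 0

/-- `H` is zero outside its first row. -/
def IsFirstRow {F : Type*} [Zero F] {p q : ℕ} (H : Matrix (Fin p) (Fin q) F) : Prop :=
  ∀ (i : Fin p) (j : Fin q), (i : ℕ) ≠ 0 → H i j = 0

theorem Fmat_mul_apply {F n : Type*} [NonAssocSemiring F] {p : ℕ}
    (R : Matrix (Fin (p - 1)) n F) (i : Fin p) (j : n) :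
    (Fmat F p * R) i j = if h : (i : ℕ) < p - 1 then R ⟨i, h⟩ j else 0 := by
  simp only [Matrix.mul_apply, Fmat, Matrix.of_apply, ite_mul, one_mul, zero_mul]
  split_ifs with h
  · rw [Finset.sum_eq_single ⟨i, h⟩] <;> simp +contextual [Fin.ext_iff, eq_comm]
  · exact Finset.sum_eq_zero fun k _ => if_neg (by omega)

theorem Kmat_mul_apply {F n : Type*} [NonAssocSemiring F] {p : ℕ}
    (R : Matrix (Fin (p - 1)) n F) (i : Fin p) (j : n) :
    (Kmat F p * R) i j = if h : (i : ℕ) ≠ 0 then R ⟨i - 1, by omega⟩ j else 0 := by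
  simp only [Matrix.mul_apply, Kmat, Matrix.of_apply, ite_mul, one_mul, zero_mul]
  split_ifs with h
  · rw [Finset.sum_eq_single ⟨i - 1, by omega⟩]
    · exact if_pos (by simp only; omega)
    · intro k _ hk
      exact if_neg fun e => hk (Fin.ext (by simp only; omega))
    · simp
  · exact Finset.sum_eq_zero fun k _ => if_neg (by omega)

theorem mul_Fmat_transpose_apply {F m : Type*} [CommSemiring F] {q : ℕ}
    (S : Matrix m (Fin (q - 1)) F) (i : m) (j : Fin q) :
    (S * (Fmat F q)ᵀ) i j = if h : (j : ℕ) < q - 1 then S i ⟨j, h⟩ else 0 := by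
  have h := Fmat_mul_apply Sᵀ j i
  rwa [← Matrix.transpose_apply (Fmat F q * Sᵀ), Matrix.transpose_mul,
    Matrix.transpose_transpose] at h

theorem mul_Kmat_transpose_apply {F m : Type*} [CommSemiring F] {q : ℕ}
    (S : Matrix m (Fin (q - 1)) F) (i : m) (j : Fin q) :
    (S * (Kmat F q)ᵀ) i j = if h : (j : ℕ) ≠ 0 then S i ⟨j - 1, by omega⟩ else 0 := by
  have h := Kmat_mul_apply Sᵀ j i
  rwa [← Matrix.transpose_apply (Kmat F q * Sᵀ), Matrix.transpose_mul,
    Matrix.transpose_transpose] at h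

/-- The extension of a matrix by zero to all pairs of natural numbers. -/
def extendByZero {F : Type*} [Zero F] {p q : ℕ} (M : Matrix (Fin p) (Fin q) F) (i j : ℕ) : F :=
  if h : i < p ∧ j < q then M ⟨i, h.1⟩ ⟨j, h.2⟩ else 0

theorem extendByZero_val {F : Type*} [Zero F] {p q : ℕ} (M : Matrix (Fin p) (Fin q) F)
    (i : Fin p) (j : Fin q) : extendByZero M i j = M i j := by
  simp [extendByZero]

theorem extendByZero_of_le {F : Type*} [Zero F] {p q : ℕ} (M : Matrix (Fin p) (Fin q) F)
    {i : ℕ} (hi : p ≤ i) (j : ℕ) : extendByZero M i j = 0 :=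
  dif_neg (by omega)

/-- The solution of `r j i = n (i + 1) j + r (j - 1) (i + 1) - m (i + 1) (j - 1)`, the last two
terms being absent for `j = 0`. -/
def antidiagonalSum {F : Type*} [AddGroup F] (m n : ℕ → ℕ → F) : ℕ → ℕ → F
  | 0, i => n (i + 1) 0
  | j + 1, i => n (i + 1) (j + 1) + (antidiagonalSum m n j (i + 1) - m (i + 1) j)

theorem antidiagonalSum_extendByZero_of_le {F : Type*} [AddGroup F] {p q : ℕ}
    (M N : Matrix (Fin p) (Fin q) F) (j : ℕ) {i : ℕ} (hi : p ≤ i + 1) :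
    antidiagonalSum (extendByZero M) (extendByZero N) j i = 0 := by
  induction j generalizing i with
  | zero => exact extendByZero_of_le N hi 0
  | succ j ih =>
    simp [antidiagonalSum, extendByZero_of_le _ hi, ih (show p ≤ i + 1 + 1 by omega)]

theorem exists_pencil_reduction {F : Type*} [CommRing F] {p q : ℕ}
    (M N : Matrix (Fin p) (Fin q) F) :
    ∃ (S : Matrix (Fin p) (Fin (q - 1)) F) (R : Matrix (Fin (p - 1)) (Fin q) F),
      IsLastCol (M + S * (Fmat F q)ᵀ - Fmat F p * R) ∧
      IsFirstRow (N + S * (Kmat F q)ᵀ - Kmat F p * R) := by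
  set r := antidiagonalSum (extendByZero M) (extendByZero N) with hr
  refine ⟨Matrix.of fun i j => r j i - extendByZero M i j, Matrix.of fun i j => r j i, ?_, ?_⟩
  · intro i j hj
    have hj' : (j : ℕ) < q - 1 := by omega
    simp only [Matrix.sub_apply, Matrix.add_apply, Fmat_mul_apply, mul_Fmat_transpose_apply,
      Matrix.of_apply, dif_pos hj', extendByZero_val]
    split_ifs with hi
    · ring
    · rw [hr, antidiagonalSum_extendByZero_of_le M N j (show p ≤ (i : ℕ) + 1 by omega)]
      ring
  · intro i j hi
    obtain ⟨k, hk⟩ := Nat.exists_eq_succ_of_ne_zero hi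
    simp only [Matrix.sub_apply, Matrix.add_apply, Kmat_mul_apply, mul_Kmat_transpose_apply,
      Matrix.of_apply, dif_pos hi]
    rw [← extendByZero_val N i j]
    split_ifs with hj
    · obtain ⟨l, hl⟩ := Nat.exists_eq_succ_of_ne_zero hj
      simp [hk, hl, hr, antidiagonalSum]
    · simp [hk, not_not.mp hj, hr, antidiagonalSum]

theorem pencil_reduction_unique {F : Type*} [CommRing F] {p q : ℕ}
    {M N : Matrix (Fin p) (Fin q) F} {S S' : Matrix (Fin p) (Fin (q - 1)) F}
    {R R' : Matrix (Fin (p - 1)) (Fin q) F}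
    (h₁ : IsLastCol (M + S * (Fmat F q)ᵀ - Fmat F p * R))
    (h₂ : IsFirstRow (N + S * (Kmat F q)ᵀ - Kmat F p * R))
    (h₁' : IsLastCol (M + S' * (Fmat F q)ᵀ - Fmat F p * R'))
    (h₂' : IsFirstRow (N + S' * (Kmat F q)ᵀ - Kmat F p * R')) :
    S = S' ∧ R = R' := by
  have sub_S (i : Fin p) (j : ℕ) (hj : j < q - 1) : S i ⟨j, hj⟩ - S' i ⟨j, hj⟩ =
      if h : (i : ℕ) < p - 1 then R ⟨i, h⟩ ⟨j, by omega⟩ - R' ⟨i, h⟩ ⟨j, by omega⟩ else 0 := by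
    have e := h₁ i ⟨j, by omega⟩ hj.ne
    have e' := h₁' i ⟨j, by omega⟩ hj.ne
    simp only [Matrix.sub_apply, Matrix.add_apply, Fmat_mul_apply, mul_Fmat_transpose_apply,
      dif_pos hj] at e e'
    split_ifs at e e' ⊢ <;> linear_combination e - e'
  have sub_R (i : ℕ) (hi : i < p - 1) (j : Fin q) : R ⟨i, hi⟩ j - R' ⟨i, hi⟩ j =
      if h : (j : ℕ) ≠ 0 then
        S ⟨i + 1, by omega⟩ ⟨j - 1, by omega⟩ - S' ⟨i + 1, by omega⟩ ⟨j - 1, by omega⟩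
      else 0 := by
    have e := h₂ ⟨i + 1, by omega⟩ j (Nat.succ_ne_zero i)
    have e' := h₂' ⟨i + 1, by omega⟩ j (Nat.succ_ne_zero i)
    simp only [Matrix.sub_apply, Matrix.add_apply, Kmat_mul_apply, mul_Kmat_transpose_apply,
      dif_pos (Nat.succ_ne_zero i), Nat.add_sub_cancel] at e e'
    split_ifs at e e' ⊢ <;> linear_combination e' - e
  have eq_R (j : ℕ) (hj : j < q) (i : ℕ) (hi : i < p - 1) :
      R ⟨i, hi⟩ ⟨j, hj⟩ = R' ⟨i, hi⟩ ⟨j, hj⟩ := by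
    induction j generalizing i with
    | zero => exact sub_eq_zero.mp ((sub_R i hi ⟨0, hj⟩).trans (dif_neg (by simp)))
    | succ j ih =>
      refine sub_eq_zero.mp ((sub_R i hi ⟨j + 1, hj⟩).trans ?_)
      rw [dif_pos (Nat.succ_ne_zero j)]
      refine (sub_S ⟨i + 1, by omega⟩ j (by omega)).trans ?_
      split_ifs with h
      · exact sub_eq_zero.mpr (ih (by omega) (i + 1) h)
      · rfl
  refine ⟨Matrix.ext fun i j => ?_, Matrix.ext fun i j => eq_R j j.2 i i.2⟩
  refine sub_eq_zero.mp ((sub_S i j j.2).trans ?_)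
  split_ifs with h
  · exact sub_eq_zero.mpr (eq_R j (by omega) i h)
  · rfl

/-- Case 4 of the paper's Theorem 3.1: interaction of the Kronecker summands
`(F_p, K_p)` and `(F_q^T, K_q^T)`. -/
theorem pencil_case4 (F : Type*) [RCLike F] (p q : ℕ) (hp : 1 ≤ p) (hq : 1 ≤ q)
    (M N : Matrix (Fin p) (Fin q) F) :
    (∃ (S : Matrix (Fin p) (Fin (q - 1)) F) (R : Matrix (Fin (p - 1)) (Fin q) F)
        (H₁ H₂ : Matrix (Fin p) (Fin q) F), IsLastCol H₁ ∧ IsFirstRow H₂ ∧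
        M + S * (Fmat F q)ᵀ - Fmat F p * R = H₁ ∧
        N + S * (Kmat F q)ᵀ - Kmat F p * R = H₂) ∧
    (∀ (S S' : Matrix (Fin p) (Fin (q - 1)) F) (R R' : Matrix (Fin (p - 1)) (Fin q) F)
        (H₁ H₂ H₁' H₂' : Matrix (Fin p) (Fin q) F),
        IsLastCol H₁ → IsFirstRow H₂ → IsLastCol H₁' → IsFirstRow H₂' →
        M + S * (Fmat F q)ᵀ - Fmat F p * R = H₁ →
        N + S * (Kmat F q)ᵀ - Kmat F p * R = H₂ →
        M + S' * (Fmat F q)ᵀ - Fmat F p * R' = H₁' →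
        N + S' * (Kmat F q)ᵀ - Kmat F p * R' = H₂' → H₁ = H₁' ∧ H₂ = H₂') := by
  constructor
  · obtain ⟨S, R, h₁, h₂⟩ := exists_pencil_reduction M N
    exact ⟨S, R, _, _, h₁, h₂, rfl, rfl⟩
  · rintro S S' R R' _ _ _ _ h₁ h₂ h₁' h₂' rfl rfl rfl rfl
    obtain ⟨rfl, rfl⟩ := pencil_reduction_unique h₁ h₂ h₁' h₂'
    exact ⟨rfl, rfl⟩
end
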